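/- arXiv:0910.2271 — 2 statements merged into one kernel-verified Lean document; each statement's English description precedes it below -/
import Mathlib

section
/- Let q ≥ 6 be an integer and let T be the real matrix indexed by Fin q × Fin q defined by: T((x1,x2),(y1,y2)) = α = 1/((q−1)(q−3)) if {x1,x2} ∩ {y1,y2} = ∅, x1 ≠ x2 and y1 ≠ y2; = β = 1/((q−1)(q−2)) if x1 = x2, y1 ≠ y2 and x1 ∉ {y1,y2}; = β if y1 = y2, x1 ≠ x2 and y1 ∉ {x1,x2}; and = 0 otherwise. Then every entry of the matrix product T² = T·T is at least (q−5)·(q−4) / ((q−3)²·(q−2)·(q−1)). -/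
open Matrix

/-- The symmetric Markov operator `T` on `[q]²` from Lemma `lemma:T`:
with `α = 1/((q−1)(q−3))` and `β = 1/((q−1)(q−2))`,
`T((x₁,x₂),(y₁,y₂)) = α` if `{x₁,x₂} ∩ {y₁,y₂} = ∅`, `x₁ ≠ x₂`, `y₁ ≠ y₂`;
`= β` if `x₁ = x₂`, `y₁ ≠ y₂`, `x₁ ∉ {y₁,y₂}`;
`= β` if `y₁ = y₂`, `x₁ ≠ x₂`, `y₁ ∉ {x₁,x₂}`; and `= 0` otherwise. -/
noncomputable def TOp (q : ℕ) : Matrix (Fin q × Fin q) (Fin q × Fin q) ℝ :=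
  fun x y =>
    if x.1 ≠ x.2 ∧ y.1 ≠ y.2 ∧ x.1 ≠ y.1 ∧ x.1 ≠ y.2 ∧ x.2 ≠ y.1 ∧ x.2 ≠ y.2
      then 1 / (((q : ℝ) - 1) * ((q : ℝ) - 3))
    else if x.1 = x.2 ∧ y.1 ≠ y.2 ∧ x.1 ≠ y.1 ∧ x.1 ≠ y.2
      then 1 / (((q : ℝ) - 1) * ((q : ℝ) - 2))
    else if y.1 = y.2 ∧ x.1 ≠ x.2 ∧ y.1 ≠ x.1 ∧ y.1 ≠ x.2
      then 1 / (((q : ℝ) - 1) * ((q : ℝ) - 2))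
    else 0

lemma TOp_nonneg {q : ℕ} (hq : 3 ≤ q) (x y : Fin q × Fin q) : 0 ≤ TOp q x y := by
  have h : (3 : ℝ) ≤ q := by exact_mod_cast hq
  have hα : 0 ≤ 1 / (((q : ℝ) - 1) * ((q : ℝ) - 3)) :=
    one_div_nonneg.2 (mul_nonneg (by linarith) (by linarith))
  have hβ : 0 ≤ 1 / (((q : ℝ) - 1) * ((q : ℝ) - 2)) :=
    one_div_nonneg.2 (mul_nonneg (by linarith) (by linarith))
  unfold TOp
  split_ifs <;> first | assumption | exact le_rfl

/-- A nonnegative function on pairs that is at least `a` on off-diagonal and at least `b` on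
diagonal pairs avoiding a set `S` of at most `k` points has a correspondingly large sum. -/
lemma le_sum_of_le_on_compl {q k : ℕ} (S : Finset (Fin q)) (hS : S.card ≤ k) (hk : k + 1 ≤ q)
    (f : Fin q × Fin q → ℝ) {a b : ℝ} (hf : ∀ z, 0 ≤ f z) (ha : 0 ≤ a) (hb : 0 ≤ b)
    (hoff : ∀ u v, u ∉ S → v ∉ S → u ≠ v → a ≤ f (u, v))
    (hdiag : ∀ u, u ∉ S → b ≤ f (u, u)) :
    ((q : ℝ) - k) * ((q : ℝ) - k - 1) * a + ((q : ℝ) - k) * b ≤ ∑ z, f z := by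
  have hn : (q : ℝ) - k ≤ (Sᶜ.card : ℝ) := by
    have h : q ≤ Sᶜ.card + k := by
      have := Finset.card_add_card_compl S
      rw [Fintype.card_fin] at this
      omega
    have : (q : ℝ) ≤ Sᶜ.card + k := by exact_mod_cast h
    linarith
  have hk' : (1 : ℝ) ≤ (q : ℝ) - k := by
    have : (k : ℝ) + 1 ≤ q := by exact_mod_cast hk
    linarith
  have hoff_card : (Sᶜ.offDiag.card : ℝ) = (Sᶜ.card : ℝ) * ((Sᶜ.card : ℝ) - 1) := by
    rw [Finset.offDiag_card, Nat.cast_sub (Nat.le_mul_self _)]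
    push_cast
    ring
  have hsum_off : (Sᶜ.offDiag.card : ℝ) * a ≤ ∑ z ∈ Sᶜ.offDiag, f z := by
    rw [← nsmul_eq_mul]
    refine Finset.card_nsmul_le_sum _ _ _ fun z hz => ?_
    simp only [Finset.mem_offDiag, Finset.mem_compl] at hz
    exact hoff z.1 z.2 hz.1 hz.2.1 hz.2.2
  have hsum_diag : (Sᶜ.card : ℝ) * b ≤ ∑ z ∈ Sᶜ.diag, f z := by
    rw [← Finset.diag_card, ← nsmul_eq_mul]
    refine Finset.card_nsmul_le_sum _ _ _ fun z hz => ?_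
    obtain ⟨u, v⟩ := z
    simp only [Finset.mem_diag, Finset.mem_compl] at hz
    obtain ⟨hu, rfl⟩ := hz
    exact hdiag u hu
  have hsplit : ∑ z ∈ Sᶜ.diag, f z + ∑ z ∈ Sᶜ.offDiag, f z ≤ ∑ z, f z := by
    rw [← Finset.sum_union (Finset.disjoint_diag_offDiag _)]
    exact Finset.sum_le_sum_of_subset_of_nonneg (Finset.subset_univ _) fun z _ _ => hf z
  have hmain : ((q : ℝ) - k) * ((q : ℝ) - k - 1) * a + ((q : ℝ) - k) * b ≤
      (Sᶜ.card : ℝ) * ((Sᶜ.card : ℝ) - 1) * a + (Sᶜ.card : ℝ) * b := by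
    have : 0 ≤ (q : ℝ) - k - 1 := by linarith
    have : 0 ≤ (Sᶜ.card : ℝ) := by positivity
    gcongr
  rw [hoff_card] at hsum_off
  linarith

lemma TOp_symm {q : ℕ} (x y : Fin q × Fin q) : TOp q x y = TOp q y x := by
  unfold TOp
  grind

lemma TOp_of_disjoint {q : ℕ} {x y : Fin q × Fin q} (hx : x.1 ≠ x.2) (hy : y.1 ≠ y.2)
    (h₁ : y.1 ∉ ({x.1, x.2} : Finset (Fin q))) (h₂ : y.2 ∉ ({x.1, x.2} : Finset (Fin q))) :
    TOp q x y = 1 / (((q : ℝ) - 1) * ((q : ℝ) - 3)) := by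
  simp only [Finset.mem_insert, Finset.mem_singleton, not_or] at h₁ h₂
  exact if_pos ⟨hx, hy, Ne.symm h₁.1, Ne.symm h₂.1, Ne.symm h₁.2, Ne.symm h₂.2⟩

lemma TOp_of_diag {q : ℕ} {x y : Fin q × Fin q} (hx : x.1 = x.2) (hy : y.1 ≠ y.2)
    (h₁ : x.1 ≠ y.1) (h₂ : x.1 ≠ y.2) :
    TOp q x y = 1 / (((q : ℝ) - 1) * ((q : ℝ) - 2)) := by
  unfold TOp
  rw [if_neg (fun h => h.1 hx), if_pos ⟨hx, hy, h₁, h₂⟩]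

lemma TOp_sq_bound_offDiag {q : ℕ} (hq : 6 ≤ q) {x y : Fin q × Fin q}
    (hx : x.1 ≠ x.2) (hy : y.1 ≠ y.2) :
    ((q : ℝ) - 5) * ((q : ℝ) - 4) /
        ((((q : ℝ) - 3) ^ 2) * ((q : ℝ) - 2) * ((q : ℝ) - 1))
      ≤ (TOp q * TOp q) x y := by
  have h6 : (6 : ℝ) ≤ q := by exact_mod_cast hq
  rw [Matrix.mul_apply]
  set α : ℝ := 1 / (((q : ℝ) - 1) * ((q : ℝ) - 3)) with hα
  set β : ℝ := 1 / (((q : ℝ) - 1) * ((q : ℝ) - 2)) with hβ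
  have h := le_sum_of_le_on_compl (k := 4) {x.1, x.2, y.1, y.2} Finset.card_le_four (by omega)
    (fun z => TOp q x z * TOp q z y) (a := α * α) (b := β * β)
    (fun z => mul_nonneg (TOp_nonneg (by omega) _ _) (TOp_nonneg (by omega) _ _))
    (mul_self_nonneg _) (mul_self_nonneg _)
    (fun u v hu hv huv => by
      rw [TOp_symm (u, v) y, TOp_of_disjoint hx huv (by grind) (by grind),
        TOp_of_disjoint hy huv (by grind) (by grind)])
    (fun u hu => by
      rw [TOp_symm x, TOp_of_diag rfl hx (by grind) (by grind),
        TOp_of_diag rfl hy (by grind) (by grind)])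
  refine le_trans ?_ h
  obtain ⟨t, ht⟩ : ∃ t : ℝ, (q : ℝ) = t + 6 := ⟨q - 6, by ring⟩
  have ht0 : 0 ≤ t := by linarith
  rw [hα, hβ, ht, ← sub_nonneg]
  have key : 0 ≤ (t + 2) * (t + 5) / ((t + 3) ^ 2 * (t + 4) ^ 2 * (t + 5) ^ 2) := by positivity
  refine key.trans_eq ?_
  have e1 : t + 6 - 1 = t + 5 := by ring
  have e2 : t + 6 - 2 = t + 4 := by ring
  have e3 : t + 6 - 3 = t + 3 := by ring
  push_cast
  rw [e1, e2, e3]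
  field_simp
  ring

lemma TOp_sq_bound_diag_offDiag {q : ℕ} (hq : 6 ≤ q) {x y : Fin q × Fin q}
    (hx : x.1 = x.2) (hy : y.1 ≠ y.2) :
    ((q : ℝ) - 5) * ((q : ℝ) - 4) /
        ((((q : ℝ) - 3) ^ 2) * ((q : ℝ) - 2) * ((q : ℝ) - 1))
      ≤ (TOp q * TOp q) x y := by
  have h6 : (6 : ℝ) ≤ q := by exact_mod_cast hq
  rw [Matrix.mul_apply]
  set α : ℝ := 1 / (((q : ℝ) - 1) * ((q : ℝ) - 3)) with hα
  set β : ℝ := 1 / (((q : ℝ) - 1) * ((q : ℝ) - 2)) with hβ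
  have hnonneg : ∀ z, 0 ≤ TOp q x z * TOp q z y := fun z =>
    mul_nonneg (TOp_nonneg (by omega) _ _) (TOp_nonneg (by omega) _ _)
  have h := le_sum_of_le_on_compl (k := 3) {x.1, y.1, y.2} Finset.card_le_three (by omega)
    (fun z => TOp q x z * TOp q z y) (a := β * α) (b := 0) hnonneg
    (mul_nonneg (one_div_nonneg.2 (mul_nonneg (by linarith) (by linarith)))
      (one_div_nonneg.2 (mul_nonneg (by linarith) (by linarith)))) le_rfl
    (fun u v hu hv huv => by
      rw [TOp_symm (u, v) y, TOp_of_diag hx huv (by grind) (by grind),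
        TOp_of_disjoint hy huv (by grind) (by grind)])
    (fun u _ => hnonneg _)
  refine le_trans ?_ h
  obtain ⟨t, ht⟩ : ∃ t : ℝ, (q : ℝ) = t + 6 := ⟨q - 6, by ring⟩
  have ht0 : 0 ≤ t := by linarith
  rw [hα, hβ, ht, ← sub_nonneg]
  have key : 0 ≤ 4 * (t + 2) / ((t + 3) ^ 2 * (t + 4) * (t + 5) ^ 2) := by positivity
  refine key.trans_eq ?_
  have e1 : t + 6 - 1 = t + 5 := by ring
  have e2 : t + 6 - 2 = t + 4 := by ring
  have e3 : t + 6 - 3 = t + 3 := by ring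
  push_cast
  rw [e1, e2, e3]
  field_simp
  ring

lemma TOp_sq_bound_diag {q : ℕ} (hq : 6 ≤ q) {x y : Fin q × Fin q}
    (hx : x.1 = x.2) (hy : y.1 = y.2) :
    ((q : ℝ) - 5) * ((q : ℝ) - 4) /
        ((((q : ℝ) - 3) ^ 2) * ((q : ℝ) - 2) * ((q : ℝ) - 1))
      ≤ (TOp q * TOp q) x y := by
  have h6 : (6 : ℝ) ≤ q := by exact_mod_cast hq
  rw [Matrix.mul_apply]
  set β : ℝ := 1 / (((q : ℝ) - 1) * ((q : ℝ) - 2)) with hβ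
  have hnonneg : ∀ z, 0 ≤ TOp q x z * TOp q z y := fun z =>
    mul_nonneg (TOp_nonneg (by omega) _ _) (TOp_nonneg (by omega) _ _)
  have h := le_sum_of_le_on_compl (k := 2) {x.1, y.1} Finset.card_le_two (by omega)
    (fun z => TOp q x z * TOp q z y) (a := β * β) (b := 0) hnonneg
    (mul_self_nonneg _) le_rfl
    (fun u v hu hv huv => by
      rw [TOp_symm (u, v) y, TOp_of_diag hx huv (by grind) (by grind),
        TOp_of_diag hy huv (by grind) (by grind)])
    (fun u _ => hnonneg _)
  refine le_trans ?_ h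
  obtain ⟨t, ht⟩ : ∃ t : ℝ, (q : ℝ) = t + 6 := ⟨q - 6, by ring⟩
  have ht0 : 0 ≤ t := by linarith
  rw [hβ, ht, ← sub_nonneg]
  have key : 0 ≤ ((t + 3) ^ 3 - (t + 1) * (t + 2) * (t + 5)) /
      ((t + 3) ^ 2 * (t + 4) * (t + 5) ^ 2) := by
    have : 0 ≤ (t + 3) ^ 3 - (t + 1) * (t + 2) * (t + 5) := by
      ring_nf
      positivity
    positivity
  refine key.trans_eq ?_
  have e1 : t + 6 - 1 = t + 5 := by ring
  have e2 : t + 6 - 2 = t + 4 := by ring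
  have e3 : t + 6 - 3 = t + 3 := by ring
  push_cast
  rw [e1, e2, e3]
  field_simp
  ring

/-- For `q ≥ 6`, every entry of `T²` is at least
`(q−5)(q−4) / ((q−3)²(q−2)(q−1))`. -/
theorem TOp_sq_entrywise_lower_bound (q : ℕ) (hq : 6 ≤ q) :
    ∀ x y : Fin q × Fin q,
      ((q : ℝ) - 5) * ((q : ℝ) - 4) /
          ((((q : ℝ) - 3) ^ 2) * ((q : ℝ) - 2) * ((q : ℝ) - 1))
        ≤ (TOp q * TOp q) x y := by
  intro x y
  by_cases hx : x.1 = x.2 <;> by_cases hy : y.1 = y.2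
  · exact TOp_sq_bound_diag hq hx hy
  · exact TOp_sq_bound_diag_offDiag hq hx hy
  · have hsymm : (TOp q * TOp q) x y = (TOp q * TOp q) y x := by
      simp only [Matrix.mul_apply]
      refine Finset.sum_congr rfl fun z _ => ?_
      rw [TOp_symm x z, TOp_symm z y, mul_comm]
    rw [hsymm]
    exact TOp_sq_bound_diag_offDiag hq hy hx
  · exact TOp_sq_bound_offDiag hq hx hy
end

section
/- Let G = (V,E) be a finite simple graph with M edges, K a positive integer, L ∈ {1,2}, and B a real number with B ≤ M/(33·K). Suppose that for every coloring c : V → Fin K, the number of edges {u,v} ∈ E with c u = c v is at least B. Form the edge-weighted graph H on vertex set V ⊕ Fin L by keeping every edge of G with weight 1, adding for every v ∈ V and every i ∈ Fin L an edge between v and the new vertex u_i of weight deg_G(v)/K, and, when L = 2, adding the edge {u_0, u_1} of weight M/(33·K). Then for every coloring χ : V ⊕ Fin L → Fin (K + L), the total weight of edges of H whose two endpoints receive equal colors under χ is at least B. -/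
open Finset

/-- The total weight of monochromatic edges, under a coloring
`χ : V ⊕ Fin L → Fin (K + L)`, of the padded weighted graph `H` obtained from
`G`: edges of `G` have weight `1`; each new vertex `uᵢ` (for `i : Fin L`) is
joined to every `v ∈ V` by an edge of weight `deg_G(v)/K`; and when `L = 2`
the two new vertices are joined by an edge of weight `M/(33·K)` (for `L = 1`
there is no pair of distinct new vertices, so that term vanishes). -/
noncomputable def padMonoWeight {V : Type*} [Fintype V] [DecidableEq V]
    (G : SimpleGraph V) [DecidableRel G.Adj] (K L M : ℕ)
    (χ : V ⊕ Fin L → Fin (K + L)) : ℝ :=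
  ((G.edgeFinset.filter fun e => (e.map fun v => χ (Sum.inl v)).IsDiag).card : ℝ)
    + ∑ v : V, ∑ i : Fin L,
        (if χ (Sum.inl v) = χ (Sum.inr i) then (G.degree v : ℝ) / K else 0)
    + (if ∃ i j : Fin L, i ≠ j ∧ χ (Sum.inr i) = χ (Sum.inr j)
        then (M : ℝ) / (33 * K) else 0)

/-- The edges of `G` with both endpoints in `S` that are monochromatic under `c`. -/
def SimpleGraph.monoEdgesIn {V α : Type*} [Fintype V] [DecidableEq V] [DecidableEq α]
    (G : SimpleGraph V) [DecidableRel G.Adj] (S : Finset V) (c : V → α) : Finset (Sym2 V) :=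
  G.edgeFinset.filter fun e => (∀ w ∈ e, w ∈ S) ∧ (e.map c).IsDiag

theorem SimpleGraph.exists_card_monoEdgesIn_insert_le {V α : Type*} [Fintype V] [DecidableEq V]
    [Fintype α] [DecidableEq α] [Nonempty α] (G : SimpleGraph V) [DecidableRel G.Adj]
    (S : Finset V) (c : V → α) {v : V} (hv : v ∉ S) :
    ∃ a, ((G.monoEdgesIn (insert v S) (Function.update c v a)).card : ℝ) ≤
      (G.monoEdgesIn S c).card + (G.degree v : ℝ) / Fintype.card α := by
  have hα : (0 : ℝ) < Fintype.card α := by exact_mod_cast Fintype.card_pos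
  obtain ⟨a, -, ha⟩ := Finset.exists_card_fiber_le_of_card_le_nsmul (s := G.neighborFinset v)
    (t := (univ : Finset α)) (f := c) (b := (G.degree v : ℝ) / Fintype.card α) univ_nonempty
    (by rw [card_univ, nsmul_eq_mul, mul_div_cancel₀ _ hα.ne', G.card_neighborFinset_eq_degree])
  refine ⟨a, ?_⟩
  have hsub : G.monoEdgesIn (insert v S) (Function.update c v a) ⊆
      G.monoEdgesIn S c ∪ ((G.neighborFinset v).filter fun w => c w = a).image fun w => s(v, w) := by
    intro e
    induction e using Sym2.ind with
    | _ x y =>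
      simp only [SimpleGraph.monoEdgesIn, mem_filter, mem_union, mem_image,
        SimpleGraph.mem_edgeFinset, SimpleGraph.mem_edgeSet, Sym2.mem_iff, Sym2.map_mk,
        Sym2.mk_isDiag_iff, SimpleGraph.mem_neighborFinset, forall_eq_or_imp, forall_eq, mem_insert]
      rintro ⟨hadj, ⟨hx, hy⟩, hc⟩
      by_cases hxv : x = v
      · subst hxv
        have hyx : y ≠ x := hadj.ne'
        rw [Function.update_self, Function.update_of_ne hyx] at hc
        exact Or.inr ⟨y, ⟨hadj, hc.symm⟩, rfl⟩
      · by_cases hyv : y = v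
        · subst hyv
          rw [Function.update_self, Function.update_of_ne hxv] at hc
          exact Or.inr ⟨x, ⟨hadj.symm, hc⟩, Sym2.eq_swap⟩
        · rw [Function.update_of_ne hxv, Function.update_of_ne hyv] at hc
          exact Or.inl ⟨hadj, ⟨hx.resolve_left hxv, hy.resolve_left hyv⟩, hc⟩
  have hcard := (card_le_card hsub).trans
    ((card_union_le _ _).trans (Nat.add_le_add_left card_image_le _))
  calc ((G.monoEdgesIn (insert v S) (Function.update c v a)).card : ℝ)
      ≤ (G.monoEdgesIn S c).card + ((G.neighborFinset v).filter fun w => c w = a).card := by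
        exact_mod_cast hcard
    _ ≤ _ := by gcongr

/-- Any partial coloring, defined on `A`, extends to `D ∪ A` while creating at most
`∑ v ∈ D, deg v / |α|` new monochromatic edges. -/
theorem SimpleGraph.exists_card_monoEdgesIn_union_le {V α : Type*} [Fintype V] [DecidableEq V]
    [Fintype α] [DecidableEq α] [Nonempty α] (G : SimpleGraph V) [DecidableRel G.Adj]
    (A D : Finset V) (hAD : Disjoint D A) (c : V → α) :
    ∃ c' : V → α, ((G.monoEdgesIn (D ∪ A) c').card : ℝ) ≤
      (G.monoEdgesIn A c).card + ∑ v ∈ D, (G.degree v : ℝ) / Fintype.card α := by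
  induction D using Finset.induction_on with
  | empty => exact ⟨c, by simp⟩
  | insert v D hv ih =>
    rw [disjoint_insert_left] at hAD
    obtain ⟨c', hc'⟩ := ih hAD.2
    obtain ⟨a, ha⟩ := G.exists_card_monoEdgesIn_insert_le (D ∪ A) c' (v := v) (by simp [hv, hAD.1])
    refine ⟨Function.update c' v a, ?_⟩
    rw [insert_union, sum_insert hv]
    linarith

/-- Suppose every `K`-coloring of `G` leaves at least `B`
monochromatic edges, where `B ≤ M/(33K)` and `M` is the number of edges of `G`.
Then for `L ∈ {1,2}`, every `(K+L)`-coloring of the padded weighted graph `H`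
on `V ⊕ Fin L` leaves monochromatic edges of total weight at least `B`. -/
theorem padding_reduction_soundness
    {V : Type*} [Fintype V] [DecidableEq V] (G : SimpleGraph V)
    [DecidableRel G.Adj] (M : ℕ) (hM : G.edgeFinset.card = M)
    (K : ℕ) (hK : 0 < K) (L : ℕ) (hL : L = 1 ∨ L = 2)
    (B : ℝ) (hB : B ≤ (M : ℝ) / (33 * K))
    (hsound : ∀ c : V → Fin K,
      B ≤ ((G.edgeFinset.filter fun e => (e.map c).IsDiag).card : ℝ)) :
    ∀ χ : V ⊕ Fin L → Fin (K + L), B ≤ padMonoWeight G K L M χ := by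
  intro χ
  have : Nonempty (Fin K) := ⟨⟨0, hK⟩⟩
  unfold padMonoWeight
  by_cases hu : ∃ i j : Fin L, i ≠ j ∧ χ (Sum.inr i) = χ (Sum.inr j)
  · rw [if_pos hu]
    have hnonneg : (0 : ℝ) ≤ ∑ v : V, ∑ i : Fin L,
        (if χ (Sum.inl v) = χ (Sum.inr i) then (G.degree v : ℝ) / K else 0) := by positivity
    exact hB.trans (le_add_of_nonneg_left (by positivity))
  rw [if_neg hu, add_zero]
  have hinj : Function.Injective fun i : Fin L => χ (Sum.inr i) := by
    intro i j hij
    by_contra hne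
    exact hu ⟨i, j, hne, hij⟩
  set R : Finset (Fin (K + L)) := univ.image fun i : Fin L => χ (Sum.inr i) with hR
  have hcard : Rᶜ.card = K := by
    rw [card_compl, hR, card_image_of_injective _ hinj]
    simp
  let e : (Rᶜ : Finset (Fin (K + L))) ≃ Fin K := Rᶜ.equivFinOfCardEq hcard
  let c : V → Fin K := fun v =>
    if h : χ (Sum.inl v) ∈ Rᶜ then e ⟨χ (Sum.inl v), h⟩ else ⟨0, hK⟩
  set A : Finset V := univ.filter fun v => χ (Sum.inl v) ∈ Rᶜ with hA
  obtain ⟨c', hc'⟩ := G.exists_card_monoEdgesIn_union_le A Aᶜ disjoint_compl_left c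
  have hmono : G.monoEdgesIn A c ⊆
      G.edgeFinset.filter fun e => (e.map fun v => χ (Sum.inl v)).IsDiag := by
    intro s
    induction s using Sym2.ind with
    | _ x y =>
      simp only [SimpleGraph.monoEdgesIn, mem_filter, Sym2.mem_iff, Sym2.map_mk,
        Sym2.mk_isDiag_iff, forall_eq_or_imp, forall_eq]
      rintro ⟨hadj, ⟨hx, hy⟩, hxy⟩
      have hx' := (mem_filter.mp hx).2
      have hy' := (mem_filter.mp hy).2
      simp only [c, dif_pos hx', dif_pos hy'] at hxy
      exact ⟨hadj, congrArg Subtype.val (e.injective hxy)⟩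
  have hsum : ∑ v ∈ Aᶜ, (G.degree v : ℝ) / Fintype.card (Fin K) ≤ ∑ v : V, ∑ i : Fin L,
      (if χ (Sum.inl v) = χ (Sum.inr i) then (G.degree v : ℝ) / K else 0) := by
    rw [Fintype.card_fin]
    refine (sum_le_sum fun v hv => ?_).trans
      (sum_le_sum_of_subset_of_nonneg (subset_univ Aᶜ) fun v _ _ => by positivity)
    have hvR : χ (Sum.inl v) ∈ R := by simpa [hA] using hv
    obtain ⟨i, -, hi⟩ := mem_image.mp hvR
    refine le_trans ?_ (single_le_sum (fun j _ => by positivity) (mem_univ i))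
    rw [if_pos hi.symm]
  have hall : (G.edgeFinset.filter fun e => (e.map c').IsDiag) = G.monoEdgesIn (Aᶜ ∪ A) c' := by
    simp [SimpleGraph.monoEdgesIn, union_comm Aᶜ A]
  have hB' := hsound c'
  rw [hall] at hB'
  exact hB'.trans (hc'.trans (add_le_add (by exact_mod_cast card_le_card hmono) hsum))
end
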